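/- Let X ∼ μ be a Borel probability measure on ℝ^d with E[X] = 0 and E‖X‖² < ∞. Set X̃ = X·1_{‖X‖≤1} − E[X·1_{‖X‖≤1}], Σ̃ = Cov(X̃), and let ν̃ be the law of Z + X̃ for Z ∼ γ independent of X. Then, with c₄ = (e⁴ − 5)/16, χ²(ν̃ ‖ γ) ≤ c₄ · ‖Σ̃‖_F². -/

import Mathlib

open MeasureTheory ProbabilityTheory Real ENNReal RealInnerProductSpace

noncomputable section

/-- The set of couplings of two measures `μ` and `ν`. -/
def couplings {E : Type*} [MeasurableSpace E] (μ ν : Measure E) : Set (Measure (E × E)) :=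
  {τ | τ.map Prod.fst = μ ∧ τ.map Prod.snd = ν}

/-- The Wasserstein-`p` distance, valued in `ℝ≥0∞`:
`W_p(μ,ν) = (inf over couplings τ of ∫ ‖z₁ - z₂‖^p dτ)^{1/p}`. -/
noncomputable def Wp {E : Type*} [MeasurableSpace E] [NormedAddCommGroup E]
    (p : ℝ) (μ ν : Measure E) : ℝ≥0∞ :=
  (⨅ τ ∈ couplings μ ν, ∫⁻ z : E × E, ENNReal.ofReal (‖z.1 - z.2‖ ^ p) ∂τ) ^ (1 / p)

/-- The standard Gaussian measure `N(0, I_d)` on `ℝ^d`. -/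
noncomputable def stdGaussian (d : ℕ) : Measure (EuclideanSpace ℝ (Fin d)) :=
  (Measure.pi fun _ : Fin d => gaussianReal 0 1).map
    ((EuclideanSpace.equiv (Fin d) ℝ).symm : (Fin d → ℝ) → EuclideanSpace ℝ (Fin d))

/-- The Gaussian measure `N(m, I_d)` on `ℝ^d`. -/
noncomputable def gaussianE (d : ℕ) (m : EuclideanSpace ℝ (Fin d)) :
    Measure (EuclideanSpace ℝ (Fin d)) :=
  (stdGaussian d).map (fun x => m + x)

/-- `C_p = (E_{ξ ∼ N(0,1)} |ξ|^p)^{1/p}`. -/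
noncomputable def Cconst (p : ℝ) : ℝ := (∫ ξ : ℝ, |ξ| ^ p ∂(gaussianReal 0 1)) ^ (1 / p)

/-- `K_p = max {1, C_p/2 + 1/3}`. -/
noncomputable def Kconst (p : ℝ) : ℝ := max 1 (Cconst p / 2 + 1 / 3)

/-- The constant `c₄ = (e⁴ - 5)/16`. -/
noncomputable def cFour : ℝ := (Real.exp 4 - 5) / 16

/-- The (second-moment) covariance matrix `∫ x xᵀ dμ` of a (centred) measure on `ℝ^d`. -/
noncomputable def covMat {d : ℕ} (μ : Measure (EuclideanSpace ℝ (Fin d))) :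
    Matrix (Fin d) (Fin d) ℝ :=
  Matrix.of fun i j => ∫ x, x i * x j ∂μ

/-- The Frobenius norm of a matrix. -/
noncomputable def frob {d : ℕ} (A : Matrix (Fin d) (Fin d) ℝ) : ℝ :=
  Real.sqrt (∑ i, ∑ j, (A i j) ^ 2)

/-- `τ₁ = E[‖X‖ 1_{‖X‖ > 1}]`. -/
noncomputable def tailOne {d : ℕ} (μ : Measure (EuclideanSpace ℝ (Fin d))) : ℝ :=
  ∫ x in {x : EuclideanSpace ℝ (Fin d) | 1 < ‖x‖}, ‖x‖ ∂μ

/-- `τ₂ = (E[‖X‖² 1_{‖X‖ > 1}])^{1/2}`. -/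
noncomputable def tailTwo {d : ℕ} (μ : Measure (EuclideanSpace ℝ (Fin d))) : ℝ :=
  Real.sqrt (∫ x in {x : EuclideanSpace ℝ (Fin d) | 1 < ‖x‖}, ‖x‖ ^ 2 ∂μ)

/-- `m = E[X 1_{‖X‖ ≤ 1}]`. -/
noncomputable def truncMean {d : ℕ} (μ : Measure (EuclideanSpace ℝ (Fin d))) :
    EuclideanSpace ℝ (Fin d) :=
  ∫ x in {x : EuclideanSpace ℝ (Fin d) | ‖x‖ ≤ 1}, x ∂μ

/-- `X̃ = X 1_{‖X‖ ≤ 1} - E[X 1_{‖X‖ ≤ 1}]`, as a function of `X`. -/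
noncomputable def truncCentred {d : ℕ} (μ : Measure (EuclideanSpace ℝ (Fin d)))
    (x : EuclideanSpace ℝ (Fin d)) : EuclideanSpace ℝ (Fin d) :=
  (if ‖x‖ ≤ 1 then x else 0) - truncMean μ

/-- `Σ̃ = Cov(X̃) = E[X̃ X̃ᵀ]` (note `X̃` is centred). -/
noncomputable def truncCov {d : ℕ} (μ : Measure (EuclideanSpace ℝ (Fin d))) :
    Matrix (Fin d) (Fin d) ℝ :=
  Matrix.of fun i j => ∫ x, truncCentred μ x i * truncCentred μ x j ∂μ

/-- The chi-squared divergence `χ²(ρ ‖ γ) = ∫ ((dρ/dγ) - 1)² dγ`. -/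
noncomputable def chiSqDiv {E : Type*} [MeasurableSpace E] (ρ γm : Measure E) : ℝ :=
  ∫ x, ((ρ.rnDeriv γm x).toReal - 1) ^ 2 ∂γm

/-- The Kullback–Leibler divergence `KL(ρ ‖ γ) = ∫ log (dρ/dγ) dρ`. -/
noncomputable def klDivReal {E : Type*} [MeasurableSpace E] (ρ γm : Measure E) : ℝ :=
  ∫ x, Real.log ((ρ.rnDeriv γm x).toReal) ∂ρ

/-- The Jacobian matrix `∇φ(x)` of a map `φ : ℝ^d → ℝ^d`, with entry `(i,j)` equal to
`∂φ_i/∂x_j (x)`. -/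
noncomputable def jacobianM {d : ℕ}
    (φ : EuclideanSpace ℝ (Fin d) → EuclideanSpace ℝ (Fin d))
    (x : EuclideanSpace ℝ (Fin d)) : Matrix (Fin d) (Fin d) ℝ :=
  Matrix.of fun i j => fderiv ℝ φ x (EuclideanSpace.single j (1 : ℝ)) i

/-- `τ` is a Stein kernel for the centred measure `ρ` relative to the standard Gaussian:
for all `φ ∈ C_c^∞(ℝ^d; ℝ^d)`, `E⟨X, φ(X)⟩ = E[tr(τ(X) ∇φ(X))]`. -/
def IsSteinKernel {d : ℕ} (ρ : Measure (EuclideanSpace ℝ (Fin d)))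
    (τ : EuclideanSpace ℝ (Fin d) → Matrix (Fin d) (Fin d) ℝ) : Prop :=
  ∀ φ : EuclideanSpace ℝ (Fin d) → EuclideanSpace ℝ (Fin d),
    ContDiff ℝ (⊤ : ℕ∞) φ → HasCompactSupport φ →
      ∫ x, ⟪x, φ x⟫ ∂ρ = ∫ x, Matrix.trace (τ x * jacobianM φ x) ∂ρ

/-- A second-order Taylor bound for the exponential, sharp at `t = 4`. -/
lemma exp_le_one_add_add_cFour_mul_sq {t : ℝ} (ht : |t| ≤ 4) :
    Real.exp t ≤ 1 + t + cFour * t ^ 2 := by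
  have h (s : ℝ) : HasSum (fun n : ℕ => s ^ (n + 2) / (n + 2).factorial)
      (Real.exp s - (1 + s)) := by
    have h0 := NormedSpace.expSeries_div_hasSum_exp s
    rw [← Real.exp_eq_exp_ℝ] at h0
    simpa [Finset.sum_range_succ] using (hasSum_nat_add_iff' 2).2 h0
  have hle := hasSum_le (fun n => ?_) (h t) ((h 4).mul_left (t ^ 2 / 16))
  · unfold cFour
    linarith
  · have hpow : t ^ n ≤ 4 ^ n :=
      (le_abs_self _).trans ((abs_pow t n).trans_le (pow_le_pow_left₀ (abs_nonneg t) ht n))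
    calc t ^ (n + 2) / (n + 2).factorial = t ^ 2 * t ^ n / (n + 2).factorial := by ring
      _ ≤ t ^ 2 * 4 ^ n / (n + 2).factorial := by gcongr
      _ = t ^ 2 / 16 * (4 ^ (n + 2) / (n + 2).factorial) := by ring

/-- One-dimensional Cameron–Martin formula. -/
lemma gaussianReal_one_apply_eq_setLIntegral (m : ℝ) {s : Set ℝ} (hs : MeasurableSet s) :
    gaussianReal m 1 s =
      ∫⁻ x in s, ENNReal.ofReal (Real.exp (m * x - m ^ 2 / 2)) ∂gaussianReal 0 1 := by
  rw [gaussianReal_of_var_ne_zero _ one_ne_zero, gaussianReal_of_var_ne_zero _ one_ne_zero,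
    withDensity_apply _ hs, setLIntegral_withDensity_eq_setLIntegral_mul _
      (measurable_gaussianPDF 0 1) (by fun_prop) hs]
  refine lintegral_congr fun x => ?_
  rw [Pi.mul_apply, gaussianPDF, gaussianPDF, ← ENNReal.ofReal_mul (gaussianPDFReal_nonneg _ _ _),
    gaussianPDFReal, gaussianPDFReal, mul_assoc _ (Real.exp _), ← Real.exp_add]
  congr 3
  push_cast
  ring

/-- The density of `N(y, I_d)` with respect to `N(0, I_d)`. -/
def gaussianShiftDensity {d : ℕ} (y x : EuclideanSpace ℝ (Fin d)) : ℝ≥0∞ :=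
  ENNReal.ofReal (Real.exp (⟪y, x⟫ - ‖y‖ ^ 2 / 2))

@[fun_prop]
lemma Measurable.gaussianShiftDensity {α : Type*} [MeasurableSpace α] {d : ℕ}
    {f g : α → EuclideanSpace ℝ (Fin d)} (hf : Measurable f) (hg : Measurable g) :
    Measurable fun a => gaussianShiftDensity (f a) (g a) :=
  ENNReal.measurable_ofReal.comp
    (Real.measurable_exp.comp ((hf.inner hg).sub ((hf.norm.pow_const 2).div_const 2)))

instance isProbabilityMeasure_stdGaussian (d : ℕ) :
    IsProbabilityMeasure (_root_.stdGaussian d) :=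
  Measure.isProbabilityMeasure_map (by fun_prop)

lemma lintegral_fintype_prod_ofReal {ι : Type*} [Fintype ι] {μ : ι → Measure ℝ}
    [∀ i, SigmaFinite (μ i)] {f : ι → ℝ → ℝ} (hf : ∀ i, Integrable (f i) (μ i))
    (hpos : ∀ i x, 0 ≤ f i x) :
    ∫⁻ x, ENNReal.ofReal (∏ i, f i (x i)) ∂Measure.pi μ =
      ∏ i, ∫⁻ x, ENNReal.ofReal (f i x) ∂μ i := by
  rw [← ofReal_integral_eq_lintegral_ofReal (Integrable.fintype_prod_dep hf)
      (.of_forall fun x => Finset.prod_nonneg fun i _ => hpos i _),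
    integral_fintype_prod_eq_prod,
    ENNReal.ofReal_prod_of_nonneg fun i _ => integral_nonneg (hpos i)]
  exact Finset.prod_congr rfl fun i _ =>
    ofReal_integral_eq_lintegral_ofReal (hf i) (.of_forall (hpos i))

lemma pi_gaussianReal_eq_withDensity {d : ℕ} (m : Fin d → ℝ) :
    Measure.pi (fun i => gaussianReal (m i) 1) =
      (Measure.pi fun _ : Fin d => gaussianReal 0 1).withDensity fun x =>
        ENNReal.ofReal (∏ i, Real.exp (m i * x i - m i ^ 2 / 2)) := by
  refine Measure.pi_eq fun s hs => ?_
  rw [withDensity_apply _ (MeasurableSet.univ_pi hs), Measure.restrict_pi_pi,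
    lintegral_fintype_prod_ofReal (f := fun i x => Real.exp (m i * x - m i ^ 2 / 2))
      (fun i => ?_) (fun i x => (Real.exp_pos _).le)]
  · exact Finset.prod_congr rfl fun i _ => (gaussianReal_one_apply_eq_setLIntegral _ (hs i)).symm
  · simp_rw [Real.exp_sub]
    exact ((integrable_exp_mul_gaussianReal (m i)).div_const _).integrableOn

/-- The Cameron–Martin formula for the standard Gaussian on `ℝ^d`. -/
lemma stdGaussian_map_add_eq_withDensity {d : ℕ} (y : EuclideanSpace ℝ (Fin d)) :
    (_root_.stdGaussian d).map (y + ·) =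
      (_root_.stdGaussian d).withDensity (gaussianShiftDensity y) := by
  have hmap : (Measure.pi fun _ : Fin d => gaussianReal 0 1).map (fun x i => y i + x i) =
      Measure.pi fun i => gaussianReal (y i) 1 := by
    have h := Measure.pi_map_pi (μ := fun _ : Fin d => gaussianReal 0 1)
      (f := fun i x => y i + x) fun i => by fun_prop
    simpa [gaussianReal_map_const_add] using h
  have he : Measurable ((EuclideanSpace.equiv (Fin d) ℝ).symm :
    (Fin d → ℝ) → EuclideanSpace ℝ (Fin d)) := by fun_prop
  rw [_root_.stdGaussian, Measure.map_map (by fun_prop) he]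
  have hcomp : (y + ·) ∘ ((EuclideanSpace.equiv (Fin d) ℝ).symm :
      (Fin d → ℝ) → EuclideanSpace ℝ (Fin d)) =
      (EuclideanSpace.equiv (Fin d) ℝ).symm ∘ fun x i => y i + x i := by
    ext x i
    simp
  rw [hcomp, ← Measure.map_map he (by fun_prop), hmap, pi_gaussianReal_eq_withDensity]
  ext s hs
  rw [Measure.map_apply he hs, withDensity_apply _ (he hs), withDensity_apply _ hs,
    setLIntegral_map hs (measurable_const.gaussianShiftDensity measurable_id') he]
  refine lintegral_congr fun x => ?_
  rw [gaussianShiftDensity, ← Real.exp_sum, Finset.sum_sub_distrib, EuclideanSpace.real_norm_sq_eq,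
    Finset.sum_div]
  simp [PiLp.inner_apply, mul_comm]

lemma lintegral_gaussianShiftDensity {d : ℕ} (y : EuclideanSpace ℝ (Fin d)) :
    ∫⁻ x, gaussianShiftDensity y x ∂_root_.stdGaussian d = 1 := by
  rw [← setLIntegral_univ, ← withDensity_apply _ .univ, ← stdGaussian_map_add_eq_withDensity,
    Measure.map_apply (by fun_prop) .univ]
  simp

lemma gaussianShiftDensity_mul {d : ℕ} (y z x : EuclideanSpace ℝ (Fin d)) :
    gaussianShiftDensity y x * gaussianShiftDensity z x =
      ENNReal.ofReal (Real.exp ⟪y, z⟫) * gaussianShiftDensity (y + z) x := by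
  simp only [gaussianShiftDensity]
  rw [← ENNReal.ofReal_mul (Real.exp_pos _).le, ← ENNReal.ofReal_mul (Real.exp_pos _).le,
    ← Real.exp_add, ← Real.exp_add, norm_add_sq_real, inner_add_left]
  ring_nf

lemma lintegral_gaussianShiftDensity_mul {d : ℕ} (y z : EuclideanSpace ℝ (Fin d)) :
    ∫⁻ x, gaussianShiftDensity y x * gaussianShiftDensity z x ∂_root_.stdGaussian d =
      ENNReal.ofReal (Real.exp ⟪y, z⟫) := by
  simp_rw [gaussianShiftDensity_mul]
  rw [lintegral_const_mul _ (measurable_const.gaussianShiftDensity measurable_id'),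
    lintegral_gaussianShiftDensity, mul_one]

section Convolution

variable {d : ℕ} (P : Measure (EuclideanSpace ℝ (Fin d))) [IsProbabilityMeasure P]

lemma measurable_lintegral_gaussianShiftDensity :
    Measurable fun x => ∫⁻ y, gaussianShiftDensity y x ∂P :=
  (measurable_fst.gaussianShiftDensity measurable_snd).lintegral_prod_left

lemma conv_stdGaussian_eq_withDensity :
    P ∗ _root_.stdGaussian d =
      (_root_.stdGaussian d).withDensity fun x => ∫⁻ y, gaussianShiftDensity y x ∂P := by
  ext s hs
  rw [withDensity_apply _ hs, ← lintegral_indicator_one hs,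
    Measure.lintegral_conv (measurable_one.indicator hs),
    lintegral_lintegral_swap (μ := (_root_.stdGaussian d).restrict s)
      (measurable_snd.gaussianShiftDensity measurable_fst).aemeasurable]
  refine lintegral_congr fun y => ?_
  rw [← withDensity_apply _ hs, ← stdGaussian_map_add_eq_withDensity,
    Measure.map_apply (by fun_prop) hs, ← lintegral_indicator_one
      (measurableSet_preimage (by fun_prop) hs)]
  rfl

lemma lintegral_lintegral_gaussianShiftDensity :
    ∫⁻ x, ∫⁻ y, gaussianShiftDensity y x ∂P ∂_root_.stdGaussian d = 1 := by
  rw [lintegral_lintegral_swap (measurable_snd.gaussianShiftDensity measurable_fst).aemeasurable]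
  simp [lintegral_gaussianShiftDensity]

/-- The second moment of the density of `P ∗ γ` is the exponential moment of the inner product
of two independent samples of `P`. -/
lemma lintegral_sq_lintegral_gaussianShiftDensity :
    ∫⁻ x, (∫⁻ y, gaussianShiftDensity y x ∂P) ^ 2 ∂_root_.stdGaussian d =
      ∫⁻ p, ENNReal.ofReal (Real.exp ⟪p.1, p.2⟫) ∂P.prod P := by
  have hsq (x : EuclideanSpace ℝ (Fin d)) : (∫⁻ y, gaussianShiftDensity y x ∂P) ^ 2 =
      ∫⁻ p, gaussianShiftDensity p.1 x * gaussianShiftDensity p.2 x ∂P.prod P := by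
    have hm : AEMeasurable (fun y => gaussianShiftDensity y x) P :=
      (measurable_id'.gaussianShiftDensity measurable_const).aemeasurable
    rw [sq, lintegral_prod_mul hm hm]
  have hm : Measurable (Function.uncurry fun (x : EuclideanSpace ℝ (Fin d))
      (p : EuclideanSpace ℝ (Fin d) × EuclideanSpace ℝ (Fin d)) =>
      gaussianShiftDensity p.1 x * gaussianShiftDensity p.2 x) :=
    (measurable_snd.fst.gaussianShiftDensity measurable_fst).mul
      (measurable_snd.snd.gaussianShiftDensity measurable_fst)
  rw [lintegral_congr hsq, lintegral_lintegral_swap hm.aemeasurable]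
  exact lintegral_congr fun p => lintegral_gaussianShiftDensity_mul _ _

variable {P}

lemma integrable_of_ae_norm_le {F : Type*} [NormedAddCommGroup F] {C : ℝ}
    (hb : ∀ᵐ y ∂P, ‖y‖ ≤ C) {g : EuclideanSpace ℝ (Fin d) → F} (hg : Continuous g) :
    Integrable g P := by
  obtain ⟨K, hK⟩ := (isCompact_closedBall (0 : EuclideanSpace ℝ (Fin d))
    C).exists_bound_of_continuousOn hg.continuousOn
  refine .of_bound hg.aestronglyMeasurable K ?_
  filter_upwards [hb] with y hy
  exact hK y (by simpa using hy)

lemma integral_inner_prod (hb : Integrable id P) :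
    ∫ p, ⟪p.1, p.2⟫ ∂P.prod P = ⟪∫ y, y ∂P, ∫ y, y ∂P⟫ := by
  have hcoord (i : Fin d) : (∫ y, y ∂P) i = ∫ y, y i ∂P :=
    ((EuclideanSpace.proj i : EuclideanSpace ℝ (Fin d) →L[ℝ] ℝ).integral_comp_comm hb).symm
  have hi (i : Fin d) : Integrable (fun y => y i) P :=
    (EuclideanSpace.proj i : EuclideanSpace ℝ (Fin d) →L[ℝ] ℝ).integrable_comp hb
  simp only [PiLp.inner_apply, RCLike.inner_apply, conj_trivial, hcoord]
  simp_rw [mul_comm (_ : ℝ)]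
  rw [integral_finsetSum _ fun i _ => (hi i).mul_prod (hi i)]
  exact Finset.sum_congr rfl fun i _ =>
    integral_prod_mul (fun y : EuclideanSpace ℝ (Fin d) => y i)
      (fun y : EuclideanSpace ℝ (Fin d) => y i)

lemma integral_inner_sq_prod
    (hi : ∀ i j : Fin d, Integrable (fun y : EuclideanSpace ℝ (Fin d) => y i * y j) P) :
    ∫ p, ⟪p.1, p.2⟫ ^ 2 ∂P.prod P = ∑ i, ∑ j, (∫ y, y i * y j ∂P) ^ 2 := by
  have hexp (p : EuclideanSpace ℝ (Fin d) × EuclideanSpace ℝ (Fin d)) :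
      ⟪p.1, p.2⟫ ^ 2 = ∑ i, ∑ j, (p.1 i * p.1 j) * (p.2 i * p.2 j) := by
    simp only [PiLp.inner_apply, RCLike.inner_apply, conj_trivial, sq, Finset.sum_mul_sum]
    exact Finset.sum_congr rfl fun i _ => Finset.sum_congr rfl fun j _ => by ring
  simp_rw [hexp]
  rw [integral_finsetSum _ fun i _ => integrable_finsetSum _ fun j _ => (hi i j).mul_prod (hi i j)]
  refine Finset.sum_congr rfl fun i _ => ?_
  rw [integral_finsetSum _ fun j _ => (hi i j).mul_prod (hi i j)]
  refine Finset.sum_congr rfl fun j _ => ?_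
  rw [sq]
  exact integral_prod_mul (fun y : EuclideanSpace ℝ (Fin d) => y i * y j)
    (fun y : EuclideanSpace ℝ (Fin d) => y i * y j)

lemma chiSqDiv_conv_stdGaussian (hint : Integrable (fun p => Real.exp ⟪p.1, p.2⟫) (P.prod P)) :
    chiSqDiv (P ∗ _root_.stdGaussian d) (_root_.stdGaussian d) =
      ∫ p, Real.exp ⟪p.1, p.2⟫ ∂P.prod P - 1 := by
  set f : EuclideanSpace ℝ (Fin d) → ℝ≥0∞ := fun x => ∫⁻ y, gaussianShiftDensity y x ∂P
  have hfm : Measurable f := measurable_lintegral_gaussianShiftDensity P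
  have hf1 : ∫⁻ x, f x ∂_root_.stdGaussian d = 1 := lintegral_lintegral_gaussianShiftDensity P
  have hf2 : ∫⁻ x, f x ^ 2 ∂_root_.stdGaussian d =
      ENNReal.ofReal (∫ p, Real.exp ⟪p.1, p.2⟫ ∂P.prod P) := by
    rw [ofReal_integral_eq_lintegral_ofReal hint (.of_forall fun _ => (Real.exp_pos _).le)]
    exact lintegral_sq_lintegral_gaussianShiftDensity P
  have hfin : ∀ᵐ x ∂_root_.stdGaussian d, f x < ∞ := ae_lt_top hfm (by simp [hf1])
  have hfin2 : ∀ᵐ x ∂_root_.stdGaussian d, f x ^ 2 < ∞ :=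
    hfin.mono fun x hx => ENNReal.pow_lt_top hx
  have hI1 : Integrable (fun x => (f x).toReal) (_root_.stdGaussian d) :=
    integrable_toReal_of_lintegral_ne_top hfm.aemeasurable (by simp [hf1])
  have hI2 : Integrable (fun x => (f x).toReal ^ 2) (_root_.stdGaussian d) := by
    simp_rw [← ENNReal.toReal_pow]
    exact integrable_toReal_of_lintegral_ne_top (hfm.pow_const 2).aemeasurable (by simp [hf2])
  have hE1 : ∫ x, (f x).toReal ∂_root_.stdGaussian d = 1 := by
    rw [integral_toReal hfm.aemeasurable hfin, hf1, ENNReal.toReal_one]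
  have hE2 : ∫ x, (f x).toReal ^ 2 ∂_root_.stdGaussian d =
      ∫ p, Real.exp ⟪p.1, p.2⟫ ∂P.prod P := by
    simp_rw [← ENNReal.toReal_pow]
    rw [integral_toReal (hfm.pow_const 2).aemeasurable hfin2, hf2,
      ENNReal.toReal_ofReal (integral_nonneg fun _ => (Real.exp_pos _).le)]
  rw [chiSqDiv, conv_stdGaussian_eq_withDensity]
  calc _ = ∫ x, ((f x).toReal ^ 2 - 2 * (f x).toReal + 1) ∂_root_.stdGaussian d := by
        refine integral_congr_ae ?_
        filter_upwards [Measure.rnDeriv_withDensity (_root_.stdGaussian d) hfm] with x hx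
        rw [hx]
        ring
    _ = _ := by
        have hsub : Integrable (fun x => (f x).toReal ^ 2 - 2 * (f x).toReal)
            (_root_.stdGaussian d) := hI2.sub (hI1.const_mul 2)
        rw [integral_add hsub (integrable_const _),
          integral_sub hI2 (hI1.const_mul 2), integral_const_mul, hE1, hE2]
        simp
        ring

/-- If `P` is centred and supported in the ball of radius `2`, then the divergence of `P ∗ γ`
from `γ` is controlled by the squared Frobenius norm of the covariance of `P`. -/
lemma chiSqDiv_conv_stdGaussian_le (hb : ∀ᵐ y ∂P, ‖y‖ ≤ 2) (h0 : ∫ y, y ∂P = 0) :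
    chiSqDiv (P ∗ _root_.stdGaussian d) (_root_.stdGaussian d) ≤
      cFour * ∑ i, ∑ j, (∫ y, y i * y j ∂P) ^ 2 := by
  have habs : ∀ᵐ p ∂P.prod P, |⟪p.1, p.2⟫| ≤ 4 := by
    filter_upwards [Measure.quasiMeasurePreserving_fst.ae hb,
      Measure.quasiMeasurePreserving_snd.ae hb] with p h1 h2
    calc |⟪p.1, p.2⟫| ≤ ‖p.1‖ * ‖p.2‖ := abs_real_inner_le_norm _ _
      _ ≤ 2 * 2 := by gcongr
      _ = 4 := by norm_num
  have hexp : Integrable (fun p => Real.exp ⟪p.1, p.2⟫) (P.prod P) := by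
    refine .of_bound (by fun_prop) (Real.exp 4) ?_
    filter_upwards [habs] with p hp
    rw [Real.norm_eq_abs, Real.abs_exp]
    exact Real.exp_le_exp.2 ((le_abs_self _).trans hp)
  have hin : Integrable (fun p => ⟪p.1, p.2⟫) (P.prod P) :=
    .of_bound (by fun_prop) 4 habs
  have hin2 : Integrable (fun p => ⟪p.1, p.2⟫ ^ 2) (P.prod P) := by
    refine .of_bound (by fun_prop) (4 ^ 2) ?_
    filter_upwards [habs] with p hp
    rw [Real.norm_eq_abs, abs_pow]
    gcongr
  have hE1 : ∫ p, ⟪p.1, p.2⟫ ∂P.prod P = 0 := by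
    rw [integral_inner_prod (integrable_of_ae_norm_le hb continuous_id), h0, inner_zero_left]
  have hle : ∫ p, Real.exp ⟪p.1, p.2⟫ ∂P.prod P ≤
      ∫ p, (1 + ⟪p.1, p.2⟫ + cFour * ⟪p.1, p.2⟫ ^ 2) ∂P.prod P :=
    integral_mono_ae hexp (((integrable_const _).add hin).add (hin2.const_mul _))
      (habs.mono fun p hp => exp_le_one_add_add_cFour_mul_sq hp)
  have hadd : Integrable (fun p => 1 + ⟪p.1, p.2⟫) (P.prod P) := (integrable_const _).add hin
  rw [integral_add hadd (hin2.const_mul _),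
    integral_add (integrable_const _) hin, integral_const_mul, hE1,
    integral_inner_sq_prod fun i j => integrable_of_ae_norm_le hb (by fun_prop)] at hle
  rw [chiSqDiv_conv_stdGaussian hexp]
  simp only [integral_const, probReal_univ, smul_eq_mul, mul_one] at hle
  linarith

end Convolution

section Truncation

variable {d : ℕ} (μ : Measure (EuclideanSpace ℝ (Fin d)))

lemma measurable_truncCentred : Measurable (truncCentred μ) :=
  (Measurable.ite (measurableSet_le measurable_norm measurable_const) measurable_id
    measurable_const).sub_const _

lemma truncMean_eq_integral :
    truncMean μ = ∫ x, (if ‖x‖ ≤ 1 then x else 0) ∂μ :=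
  (integral_indicator (measurableSet_le measurable_norm measurable_const)).symm

variable [IsProbabilityMeasure μ]

lemma norm_truncMean_le : ‖truncMean μ‖ ≤ 1 := by
  rw [truncMean_eq_integral]
  refine (norm_integral_le_of_norm_le_const (C := 1) (.of_forall fun x => ?_)).trans_eq (by simp)
  split_ifs with h <;> simp [h]

lemma norm_truncCentred_le (x : EuclideanSpace ℝ (Fin d)) : ‖truncCentred μ x‖ ≤ 2 := by
  have hx : ‖if ‖x‖ ≤ 1 then x else 0‖ ≤ 1 := by split_ifs with h <;> simp [h]
  exact (norm_sub_le _ _).trans (by linarith [norm_truncMean_le μ])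

lemma integral_truncCentred : ∫ x, truncCentred μ x ∂μ = 0 := by
  have hint : Integrable (fun x => if ‖x‖ ≤ 1 then x else 0) μ := by
    refine .of_bound (Measurable.ite (measurableSet_le measurable_norm measurable_const)
      measurable_id measurable_const).aestronglyMeasurable 1 (.of_forall fun x => ?_)
    split_ifs with h <;> simp [h]
  unfold truncCentred
  rw [integral_sub hint (integrable_const _), ← truncMean_eq_integral]
  simp

end Truncation

/-- chi-squared bound via the truncated covariance. -/
theorem chiSq_truncated_convolution_le
    (d : ℕ) (μ : Measure (EuclideanSpace ℝ (Fin d))) [IsProbabilityMeasure μ]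
    (hmean : ∫ x, x ∂μ = 0)
    (hmom : Integrable (fun x => ‖x‖ ^ 2) μ) :
    chiSqDiv ((μ.map (truncCentred μ)) ∗ stdGaussian d) (stdGaussian d) ≤
      cFour * frob (truncCov μ) ^ 2 := by
  have hm := measurable_truncCentred μ
  have := Measure.isProbabilityMeasure_map (μ := μ) hm.aemeasurable
  refine (chiSqDiv_conv_stdGaussian_le (P := μ.map (truncCentred μ)) ?_ ?_).trans_eq ?_
  · rw [ae_map_iff hm.aemeasurable (measurableSet_le measurable_norm measurable_const)]
    exact .of_forall (norm_truncCentred_le μ)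
  · rw [integral_map hm.aemeasurable (by fun_prop), integral_truncCentred]
  · rw [frob, Real.sq_sqrt (by positivity)]
    congr! 5 with i _ j _
    rw [integral_map hm.aemeasurable (by fun_prop)]
    rfl

end
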